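/- arXiv:2601.09956 — 5 statements merged into one kernel-verified Lean document; each statement's English description precedes it below -/
import Mathlib

section
/- Let F be an algebraically closed field of characteristic p (p an odd prime), q = p^r a power of p, and m ≥ 2 an integer. Suppose G ∈ F[x,y] is a polynomial of the form G = Σ c_{ij} x^i y^j + Σ c_{0j} y^j, where the first sum runs over pairs (i,j) with 0 ≤ j ≤ q−1 and 0 ≤ i + j ≤ m(q−2), and the second sum runs over j with q ≤ j ≤ m(q−2). If the polynomial x·y^q − x^q·y − 1 divides G in F[x,y], then all coefficients c_{ij} and c_{0j} are zero (i.e., G = 0). -/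
open MvPolynomial

/-- The exponent vector of the monomial `x ^ i * y ^ j`. -/
noncomputable def bivariateExponent (i j : ℕ) : Fin 2 →₀ ℕ :=
  Finsupp.single 0 i + Finsupp.single 1 j

theorem bivariateExponent_apply_zero (i j : ℕ) : bivariateExponent i j 0 = i := by
  simp [bivariateExponent]

theorem bivariateExponent_apply_one (i j : ℕ) : bivariateExponent i j 1 = j := by
  simp [bivariateExponent]

theorem bivariateExponent_inj {i j a b : ℕ} :
    bivariateExponent i j = bivariateExponent a b ↔ i = a ∧ j = b := by
  simp [Finsupp.ext_iff, bivariateExponent_apply_zero, bivariateExponent_apply_one]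

theorem bivariateExponent_apply_apply (d : Fin 2 →₀ ℕ) : bivariateExponent (d 0) (d 1) = d := by
  ext k
  fin_cases k
  · exact bivariateExponent_apply_zero _ _
  · exact bivariateExponent_apply_one _ _

theorem C_mul_X_pow_mul_X_pow {R : Type*} [CommSemiring R] (a : R) (i j : ℕ) :
    (C a * X 0 ^ i * X 1 ^ j : MvPolynomial (Fin 2) R) = monomial (bivariateExponent i j) a := by
  simp [X_pow_eq_monomial, C_mul_monomial, monomial_mul, bivariateExponent]

/-- The monomials not divisible by `x * y ^ q` are linearly independent modulo the Drinfeld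
curve equation. -/
theorem eq_zero_of_drinfeld_dvd {R : Type*} [CommRing R] {q : ℕ} (hq : 2 ≤ q)
    {G : MvPolynomial (Fin 2) R}
    (hdvd : (X 0 * X 1 ^ q - X 0 ^ q * X 1 - 1 : MvPolynomial (Fin 2) R) ∣ G)
    (hG : ∀ a b, coeff (bivariateExponent (a + 1) (b + q)) G = 0) : G = 0 := by
  obtain ⟨H, rfl⟩ := hdvd
  suffices H = 0 by simp [this]
  by_contra hH
  obtain ⟨d, hd, hmax⟩ := H.support.exists_max_image (fun d => d 1) (support_nonempty.mpr hH)
  have hzero : ∀ e : Fin 2 →₀ ℕ, d 1 < e 1 → coeff e H = 0 := fun e he => by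
    by_contra hne
    exact absurd (hmax e (mem_support_iff.mpr hne)) (not_le.mpr he)
  have hlead : (X 0 * X 1 ^ q : MvPolynomial (Fin 2) R) = monomial (bivariateExponent 1 q) 1 := by
    simpa using C_mul_X_pow_mul_X_pow (1 : R) 1 q
  have htail : (X 0 ^ q * X 1 : MvPolynomial (Fin 2) R) = monomial (bivariateExponent q 1) 1 := by
    simpa using C_mul_X_pow_mul_X_pow (1 : R) q 1
  have hexp : bivariateExponent (d 0 + 1) (d 1 + q) = bivariateExponent 1 q + d := by
    ext k
    fin_cases k <;> simp [bivariateExponent, add_comm]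
  have hcoeff := hG (d 0) (d 1)
  rw [sub_mul, sub_mul, one_mul, coeff_sub, coeff_sub, hlead, htail,
    hzero (bivariateExponent _ _) (by rw [bivariateExponent_apply_one]; lia), hexp,
    coeff_monomial_mul, coeff_monomial_mul', hzero (_ - _)
      (by simp [bivariateExponent_apply_one]; lia)] at hcoeff
  exact mem_support_iff.mp hd (by simpa using hcoeff)

/-- Linear independence underlying the basis of
`H⁰(C, Ω_C^{⊗m})` for the Drinfeld curve: if a polynomial of the stated shape is
divisible by `x·y^q − x^q·y − 1`, then all its coefficients vanish. -/
theorem drinfeld_linear_independence (p r q m : ℕ) (hp : p.Prime) (hodd : Odd p)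
    (hr : 1 ≤ r) (hq : q = p ^ r) (hm : 2 ≤ m)
    (F : Type) [Field F] [IsAlgClosed F] [CharP F p]
    (c : ℕ × ℕ → F)
    (hdvd : (X 0 * X 1 ^ q - X 0 ^ q * X 1 - 1 : MvPolynomial (Fin 2) F) ∣
      (∑ ij ∈ (Finset.range (m * (q - 2) + 1) ×ˢ Finset.range q).filter
          (fun ij => ij.1 + ij.2 ≤ m * (q - 2)),
        C (c ij) * X 0 ^ ij.1 * X 1 ^ ij.2)
      + ∑ j ∈ Finset.Icc q (m * (q - 2)), C (c (0, j)) * X 1 ^ j) :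
    (∀ i j : ℕ, j ≤ q - 1 → i + j ≤ m * (q - 2) → c (i, j) = 0) ∧
    (∀ j : ℕ, q ≤ j → j ≤ m * (q - 2) → c (0, j) = 0) := by
  have hq3 : 3 ≤ q := by
    have hp3 : 3 ≤ p := by
      have := hp.two_le
      obtain ⟨k, rfl⟩ := hodd
      lia
    exact hq ▸ hp3.trans (Nat.le_self_pow (by lia) p)
  set G : MvPolynomial (Fin 2) F := _ + _ with hGdef
  have hcoeff : ∀ a b, coeff (bivariateExponent a b) G =
      (if b < q ∧ a + b ≤ m * (q - 2) then c (a, b) else 0) +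
        (if a = 0 ∧ q ≤ b ∧ b ≤ m * (q - 2) then c (0, b) else 0) := by
    intro a b
    have hpow : ∀ j, (C (c (0, j)) * X 1 ^ j : MvPolynomial (Fin 2) F) =
        monomial (bivariateExponent 0 j) (c (0, j)) := fun j => by
      simpa using C_mul_X_pow_mul_X_pow (c (0, j)) 0 j
    simp only [hGdef, C_mul_X_pow_mul_X_pow, hpow, coeff_add, coeff_sum, coeff_monomial,
      bivariateExponent_inj]
    congr 1
    · simp only [← Prod.mk_inj, Prod.mk.eta, Finset.sum_ite_eq', Finset.mem_filter,
        Finset.mem_product, Finset.mem_range]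
      exact if_congr (by lia) rfl rfl
    · by_cases ha : a = 0
      · simp [ha]
      · simp [ha, Ne.symm ha]
  have hG : G = 0 := by
    refine eq_zero_of_drinfeld_dvd (by lia) hdvd fun a b => ?_
    rw [hcoeff, if_neg (by lia), if_neg (by lia), add_zero]
  refine ⟨fun i j hj hij => ?_, fun j hj hjm => ?_⟩
  · have h := hcoeff i j
    rwa [hG, coeff_zero, if_pos (by lia), if_neg (by lia), add_zero, eq_comm] at h
  · have h := hcoeff 0 j
    rwa [hG, coeff_zero, if_neg (by lia), if_pos (by lia), zero_add, eq_comm] at h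
end

section
/- Let p be an odd prime and m ≥ 2 an integer. For an integer j, let ℓ₀(j) denote the unique integer in [0, p−2] with ℓ₀(j) ≡ m − j − ⌈(2m+j)/p⌉ (mod p−1). For an integer b with 1 ≤ b ≤ p−1, define σ(b) = 1 if either (2m+b−1 ≡ 0 (mod p) and ℓ₀(b−1) ∈ {0,1}) or (2m+b−1 ≢ 0 (mod p) and ℓ₀(b−1) = 0), and σ(b) = 0 otherwise. Then for all 1 ≤ b ≤ p−1, one has ⌊(m−b+1−⌈(2m+b−1)/p⌉)/(p−1)⌋ − ⌊(m−b−⌈(2m+b)/p⌉)/(p−1)⌋ = σ(b). -/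
/-- The function `ψ(a, j)` from the decomposition of `H⁰(C, Ω_C^{⊗m})` as an
`𝔽[B]`-module for the Drinfeld curve with `q = p`.  Here `ℓ₁ = ℓ_{[1:0],j}` and
`ℓ₀ j = ℓ_{[0:1],j}`. -/
def psi (p : ℕ) (ℓ₁ : ℤ) (ℓ₀ : ℤ → ℤ) (a j : ℤ) : ℤ :=
  if a < ℓ₀ j + 1 ∧ (p : ℤ) - 1 - ℓ₁ ≤ a ∧ a ≤ (p : ℤ) - 2 then 1
  else if a < (p : ℤ) - 1 - ℓ₁ ∧ ℓ₀ j + 1 ≤ a ∧ a ≤ (p : ℤ) - 2 then -1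
  else 0

/-- The function `σ(b)`: it is `1` if either `2m+b−1 ≡ 0 (mod p)` and
`ℓ₀(b−1) ∈ {0,1}`, or `2m+b−1 ≢ 0 (mod p)` and `ℓ₀(b−1) = 0`; else `0`. -/
def sigmaB (p m : ℕ) (ℓ₀ : ℤ → ℤ) (b : ℤ) : ℤ :=
  if ((p : ℤ) ∣ (2 * (m : ℤ) + b - 1) ∧ (ℓ₀ (b - 1) = 0 ∨ ℓ₀ (b - 1) = 1))
      ∨ (¬ (p : ℤ) ∣ (2 * (m : ℤ) + b - 1) ∧ ℓ₀ (b - 1) = 0) then 1 else 0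

/-- The multiplicity `n_{a,b} = σ(b) + ψ(a,b−1) − ψ(a,b)` of the indecomposable
`𝔽[B]`-module `U_{a,b}` in `Res^G_B H⁰(C, Ω_C^{⊗m})`. -/
def nab (p m : ℕ) (ℓ₁ : ℤ) (ℓ₀ : ℤ → ℤ) (a b : ℤ) : ℤ :=
  sigmaB p m ℓ₀ b + psi p ℓ₁ ℓ₀ a (b - 1) - psi p ℓ₁ ℓ₀ a b

theorem floor_intCast_div_eq {q x k : ℤ} (hq : 0 < q) (h₁ : q * k ≤ x) (h₂ : x < q * k + q) :
    ⌊(x : ℚ) / (q : ℚ)⌋ = k := by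
  have hq' : (0 : ℚ) < q := by exact_mod_cast hq
  rw [Int.floor_eq_iff, le_div_iff₀ hq', div_lt_iff₀ hq']
  have h₁' : (q : ℚ) * k ≤ x := by exact_mod_cast h₁
  have h₂' : (x : ℚ) < q * k + q := by exact_mod_cast h₂
  constructor <;> linarith

theorem ceil_intCast_div_eq {q x k : ℤ} (hq : 0 < q) (h₁ : q * k - q < x) (h₂ : x ≤ q * k) :
    ⌈(x : ℚ) / (q : ℚ)⌉ = k := by
  have hq' : (0 : ℚ) < q := by exact_mod_cast hq
  rw [Int.ceil_eq_iff, lt_div_iff₀ hq', div_le_iff₀ hq']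
  have h₁' : (q : ℚ) * k - q < x := by exact_mod_cast h₁
  have h₂' : (x : ℚ) ≤ q * k := by exact_mod_cast h₂
  constructor <;> linarith

theorem ceil_intCast_div_bounds {q : ℤ} (hq : 0 < q) (x : ℤ) :
    q * ⌈(x : ℚ) / (q : ℚ)⌉ - q < x ∧ x ≤ q * ⌈(x : ℚ) / (q : ℚ)⌉ := by
  have hq' : (0 : ℚ) < q := by exact_mod_cast hq
  have h := (Int.ceil_eq_iff (a := (x : ℚ) / q)).1 rfl
  rw [lt_div_iff₀ hq', div_le_iff₀ hq'] at h
  obtain ⟨h₁, h₂⟩ := h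
  constructor
  · have : (q : ℚ) * ⌈(x : ℚ) / (q : ℚ)⌉ - q < x := by linarith
    exact_mod_cast this
  · have : (x : ℚ) ≤ q * ⌈(x : ℚ) / (q : ℚ)⌉ := by linarith
    exact_mod_cast this

/-- Passing from `x` to `x + 1` raises `⌈x / q⌉` by one exactly when `q ∣ x`. -/
theorem ceil_intCast_succ_div {q : ℤ} (hq : 0 < q) (x : ℤ) :
    ⌈((x + 1 : ℤ) : ℚ) / (q : ℚ)⌉ = ⌈(x : ℚ) / (q : ℚ)⌉ + if q ∣ x then 1 else 0 := by
  obtain ⟨h₁, h₂⟩ := ceil_intCast_div_bounds hq x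
  set c := ⌈(x : ℚ) / (q : ℚ)⌉
  split_ifs with hd
  · obtain ⟨t, rfl⟩ := hd
    have ht : t = c := by
      have h₃ : t ≤ c := le_of_mul_le_mul_left h₂ hq
      have h₄ : c - 1 < t := lt_of_mul_lt_mul_left (by linarith) hq.le
      omega
    rw [ht]
    apply ceil_intCast_div_eq hq <;> linarith
  · have hne : x ≠ q * c := fun h => hd ⟨c, h⟩
    apply ceil_intCast_div_eq hq <;> rw [add_zero] <;> omega

/-- The floor-difference identity
`⌊(m−b+1−⌈(2m+b−1)/p⌉)/(p−1)⌋ − ⌊(m−b−⌈(2m+b)/p⌉)/(p−1)⌋ = σ(b)`. -/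
theorem floor_difference_eq_sigma (p m : ℕ) (hp : p.Prime) (hodd : Odd p)
    (hm : 2 ≤ m)
    (ℓ₀ : ℤ → ℤ) (hℓ₀0 : ∀ j, 0 ≤ ℓ₀ j) (hℓ₀2 : ∀ j, ℓ₀ j ≤ (p : ℤ) - 2)
    (hℓ₀ : ∀ j : ℤ,
      ℓ₀ j ≡ (m : ℤ) - j - ⌈(2 * (m : ℚ) + (j : ℚ)) / (p : ℚ)⌉ [ZMOD (p : ℤ) - 1]) :
    ∀ b : ℤ, 1 ≤ b → b ≤ (p : ℤ) - 1 →
      ⌊((m : ℚ) - (b : ℚ) + 1 - (⌈(2 * (m : ℚ) + (b : ℚ) - 1) / (p : ℚ)⌉ : ℤ))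
          / ((p : ℚ) - 1)⌋
        - ⌊((m : ℚ) - (b : ℚ) - (⌈(2 * (m : ℚ) + (b : ℚ)) / (p : ℚ)⌉ : ℤ))
          / ((p : ℚ) - 1)⌋
      = sigmaB p m ℓ₀ b := by
  intro b _ _
  have hp3 : (3 : ℤ) ≤ p := by
    have := hp.two_le
    obtain ⟨k, hk⟩ := hodd
    omega
  have hq : (0 : ℤ) < (p : ℤ) - 1 := by omega
  have hsucc := ceil_intCast_succ_div (show (0 : ℤ) < p by omega) (2 * (m : ℤ) + b - 1)
  have hmod := hℓ₀ (b - 1)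
  have h0 := hℓ₀0 (b - 1)
  have h2 := hℓ₀2 (b - 1)
  have e₁ : (2 * (m : ℚ) + ((b - 1 : ℤ) : ℚ)) / (p : ℚ)
      = ((2 * (m : ℤ) + b - 1 : ℤ) : ℚ) / ((p : ℤ) : ℚ) := by push_cast; ring
  have e₂ : (2 * (m : ℚ) + (b : ℚ) - 1) / (p : ℚ)
      = ((2 * (m : ℤ) + b - 1 : ℤ) : ℚ) / ((p : ℤ) : ℚ) := by push_cast; ring
  have e₃ : (2 * (m : ℚ) + (b : ℚ)) / (p : ℚ)
      = ((2 * (m : ℤ) + b - 1 + 1 : ℤ) : ℚ) / ((p : ℤ) : ℚ) := by push_cast; ring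
  rw [e₁] at hmod
  rw [e₂, e₃, hsucc]
  unfold sigmaB
  generalize ⌈((2 * (m : ℤ) + b - 1 : ℤ) : ℚ) / ((p : ℤ) : ℚ)⌉ = c at *
  generalize ℓ₀ (b - 1) = l at *
  obtain ⟨k, hk⟩ := hmod.dvd
  have hX : ((m : ℚ) - b + 1 - (c : ℤ)) / ((p : ℚ) - 1)
      = (((m : ℤ) - b + 1 - c : ℤ) : ℚ) / (((p : ℤ) - 1 : ℤ) : ℚ) := by push_cast; ring
  have hY (d : ℤ) : ((m : ℚ) - b - ((c + d : ℤ) : ℚ)) / ((p : ℚ) - 1)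
      = (((m : ℤ) - b - (c + d) : ℤ) : ℚ) / (((p : ℤ) - 1 : ℤ) : ℚ) := by push_cast; ring
  rw [hX, hY, floor_intCast_div_eq (k := k) hq (by linarith) (by linarith)]
  by_cases hd : (p : ℤ) ∣ 2 * (m : ℤ) + b - 1
  · simp only [hd, if_true, true_and, not_true, false_and, or_false]
    split_ifs with hl
    · rw [floor_intCast_div_eq (k := k - 1) hq]
      · ring
      · rw [mul_sub]; omega
      · rw [mul_sub]; omega
    · rw [floor_intCast_div_eq (k := k) hq (by omega) (by omega), sub_self]
  · simp only [hd, if_false, false_and, not_false_eq_true, true_and, false_or]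
    split_ifs with hl
    · rw [floor_intCast_div_eq (k := k - 1) hq]
      · ring
      · rw [mul_sub]; omega
      · rw [mul_sub]; omega
    · rw [floor_intCast_div_eq (k := k) hq (by omega) (by omega), sub_self]
end

section
/- Let p be an odd prime and m ≥ 2 an integer. For an integer j, let ℓ₁ denote the unique integer in [0, p−2] with ℓ₁ ≡ m(p−2) (mod p−1), and let ℓ₀(j) denote the unique integer in [0, p−2] with ℓ₀(j) ≡ m − j − ⌈(2m+j)/p⌉ (mod p−1). Define, for 0 ≤ a ≤ p−2, ψ(a,j) = 1 if a < ℓ₀(j)+1 and p−1−ℓ₁ ≤ a ≤ p−2; ψ(a,j) = −1 if a < p−1−ℓ₁ and ℓ₀(j)+1 ≤ a ≤ p−2; and ψ(a,j) = 0 otherwise. For 1 ≤ b ≤ p−1, define σ(b) = 1 if either (2m+b−1 ≡ 0 (mod p) and ℓ₀(b−1) ∈ {0,1}) or (2m+b−1 ≢ 0 (mod p) and ℓ₀(b−1) = 0), and σ(b) = 0 otherwise; and define n(a,b) = σ(b) + ψ(a,b−1) − ψ(a,b). Then for every integer b with 1 ≤ b ≤ p−1, the sum Σ_{a=0}^{p−2}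 n(a,b) equals 2 if 2m+b−1 ≡ 0 (mod p), and equals 1 if 2m+b−1 ≢ 0 (mod p). -/
/-- Passing from `x` to `x + 1` raises `⌈x / p⌉` by one exactly when `p ∣ x`. -/
theorem ceil_succ_div (p : ℕ) (hp : 0 < p) (x : ℤ) :
    ⌈((x + 1 : ℤ) : ℚ) / (p : ℚ)⌉ = ⌈(x : ℚ) / (p : ℚ)⌉ + if (p : ℤ) ∣ x then 1 else 0 := by
  have hpQ : (0 : ℚ) < p := by exact_mod_cast hp
  have hpZ : (0 : ℤ) < p := by exact_mod_cast hp
  have hlo := Int.ceil_lt_add_one ((x : ℚ) / (p : ℚ))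
  have hhi := Int.le_ceil ((x : ℚ) / (p : ℚ))
  generalize ⌈(x : ℚ) / (p : ℚ)⌉ = c at hlo hhi ⊢
  rw [← sub_lt_iff_lt_add, lt_div_iff₀ hpQ] at hlo
  rw [div_le_iff₀ hpQ] at hhi
  norm_cast at hlo hhi
  rw [Int.ceil_eq_iff, lt_div_iff₀ hpQ, div_le_iff₀ hpQ]
  norm_cast
  split_ifs with h
  · obtain ⟨k, rfl⟩ := h
    have h1 : c - 1 < k := by nlinarith
    have h2 : k ≤ c := by nlinarith
    obtain rfl : k = c := by omega
    constructor <;> push_cast <;> nlinarith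
  · have hne : x ≠ c * p := fun e => h ⟨c, by rw [e, mul_comm]⟩
    have hlt : x < c * p := lt_of_le_of_ne hhi hne
    constructor <;> push_cast at * <;> linarith

theorem sum_Icc_ite_lt (n L : ℤ) (h0 : 0 ≤ L) (hn : L ≤ n + 1) :
    ∑ a ∈ Finset.Icc (0 : ℤ) n, (if a < L then (1 : ℤ) else 0) = L := by
  have hfilter : (Finset.Icc (0 : ℤ) n).filter (· < L) = Finset.Ico 0 L := by
    ext a
    simp only [Finset.mem_filter, Finset.mem_Icc, Finset.mem_Ico]
    omega
  rw [Finset.sum_boole, hfilter, Int.card_Ico]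
  simpa using h0

theorem sum_psi (p : ℕ) (ℓ₁ : ℤ) (ℓ₀ : ℤ → ℤ) (j : ℤ)
    (h10 : 0 ≤ ℓ₁) (h12 : ℓ₁ ≤ (p : ℤ) - 2) (h00 : 0 ≤ ℓ₀ j) (h02 : ℓ₀ j ≤ (p : ℤ) - 2) :
    ∑ a ∈ Finset.Icc (0 : ℤ) ((p : ℤ) - 2), psi p ℓ₁ ℓ₀ a j = ℓ₀ j + 1 - ((p : ℤ) - 1 - ℓ₁) := by
  conv_rhs =>
    rw [← sum_Icc_ite_lt ((p : ℤ) - 2) (ℓ₀ j + 1) (by omega) (by omega),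
      ← sum_Icc_ite_lt ((p : ℤ) - 2) ((p : ℤ) - 1 - ℓ₁) (by omega) (by omega),
      ← Finset.sum_sub_distrib]
  refine Finset.sum_congr rfl fun a ha => ?_
  rw [Finset.mem_Icc] at ha
  unfold psi
  split_ifs <;> omega

/-- An integer of absolute value less than `2 * n` that is divisible by `n` is `-n`, `0` or `n`. -/
theorem eq_of_dvd_of_abs_lt {n d : ℤ} (h : n ∣ d) (h1 : -(2 * n) < d) (h2 : d < 2 * n) :
    d = -n ∨ d = 0 ∨ d = n := by
  obtain ⟨k, rfl⟩ := h
  have hn : 0 < n := by linarith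
  have hk1 : -2 < k := by nlinarith
  have hk2 : k < 2 := by nlinarith
  obtain rfl | rfl | rfl : k = -1 ∨ k = 0 ∨ k = 1 := by omega
  all_goals simp

/-- `Σ_{a=0}^{p−2} n(a,b)` is `2` when `2m+b−1 ≡ 0 (mod p)` and
`1` otherwise. -/
theorem nab_sum (p m : ℕ) (hp : p.Prime) (hodd : Odd p) (hm : 2 ≤ m)
    (ℓ₁ : ℤ) (hℓ₁0 : 0 ≤ ℓ₁) (hℓ₁2 : ℓ₁ ≤ (p : ℤ) - 2)
    (hℓ₁ : ℓ₁ ≡ (m : ℤ) * ((p : ℤ) - 2) [ZMOD (p : ℤ) - 1])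
    (ℓ₀ : ℤ → ℤ) (hℓ₀0 : ∀ j, 0 ≤ ℓ₀ j) (hℓ₀2 : ∀ j, ℓ₀ j ≤ (p : ℤ) - 2)
    (hℓ₀ : ∀ j : ℤ,
      ℓ₀ j ≡ (m : ℤ) - j - ⌈(2 * (m : ℚ) + (j : ℚ)) / (p : ℚ)⌉ [ZMOD (p : ℤ) - 1])
    :
    ∀ b : ℤ, 1 ≤ b → b ≤ (p : ℤ) - 1 →
      ∑ a ∈ Finset.Icc (0 : ℤ) ((p : ℤ) - 2), nab p m ℓ₁ ℓ₀ a b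
        = if (p : ℤ) ∣ (2 * (m : ℤ) + b - 1) then 2 else 1 := by
  intro b _ _
  have hp3 : (3 : ℤ) ≤ p := by
    have h2 := hp.two_le
    obtain ⟨k, hk⟩ := hodd
    omega
  have hceil := ceil_succ_div p hp.pos (2 * (m : ℤ) + b - 1)
  have hdvd := ((hℓ₀ (b - 1)).sub (hℓ₀ b)).symm.dvd
  have e1 : (2 * (m : ℚ) + ((b - 1 : ℤ) : ℚ)) = ((2 * (m : ℤ) + b - 1 : ℤ) : ℚ) := by
    push_cast; ring
  have e2 : (2 * (m : ℚ) + (b : ℚ)) = ((2 * (m : ℤ) + b - 1 + 1 : ℤ) : ℚ) := by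
    push_cast; ring
  rw [e1, e2, hceil] at hdvd
  have h00 := hℓ₀0 b
  have h02 := hℓ₀2 b
  have h10 := hℓ₀0 (b - 1)
  have h12 := hℓ₀2 (b - 1)
  simp only [nab, Finset.sum_sub_distrib, Finset.sum_add_distrib, Finset.sum_const, Int.card_Icc,
    sum_psi p ℓ₁ ℓ₀ _ hℓ₁0 hℓ₁2 (hℓ₀0 _) (hℓ₀2 _), nsmul_eq_mul]
  have hcard : ((((p : ℤ) - 2 + 1 - 0).toNat : ℕ) : ℤ) = p - 1 := by omega
  rw [hcard]
  unfold sigmaB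
  generalize ⌈((2 * (m : ℤ) + b - 1 : ℤ) : ℚ) / (p : ℚ)⌉ = c at hdvd
  generalize ℓ₀ b = x at *
  generalize ℓ₀ (b - 1) = y at *
  by_cases h : (p : ℤ) ∣ 2 * (m : ℤ) + b - 1
  · simp only [h, if_true, true_and, not_true, false_and, or_false] at hdvd ⊢
    have hd : (p : ℤ) - 1 ∣ y - x - 2 := by convert hdvd using 1; ring
    rcases eq_of_dvd_of_abs_lt hd (by omega) (by omega) with e | e | e <;> split_ifs <;> omega
  · simp only [h, if_false, false_and, not_false_eq_true, true_and, false_or] at hdvd ⊢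
    have hd : (p : ℤ) - 1 ∣ y - x - 1 := by convert hdvd using 1; ring
    rcases eq_of_dvd_of_abs_lt hd (by omega) (by omega) with e | e | e <;> split_ifs <;> omega
end

section
/- Let p be an odd prime and m ≥ 2 an integer with p > 3m. For an integer j, let ℓ₁ denote the unique integer in [0, p−2] with ℓ₁ ≡ m(p−2) (mod p−1), and let ℓ₀(j) denote the unique integer in [0, p−2] with ℓ₀(j) ≡ m − j − ⌈(2m+j)/p⌉ (mod p−1). Define, for 0 ≤ a ≤ p−2, ψ(a,j) = 1 if a < ℓ₀(j)+1 and p−1−ℓ₁ ≤ a ≤ p−2; ψ(a,j) = −1 if a < p−1−ℓ₁ and ℓ₀(j)+1 ≤ a ≤ p−2; and ψ(a,j) = 0 otherwise. For 1 ≤ b ≤ p−1, define σ(b) = 1 if either (2m+b−1 ≡ 0 (mod p) and ℓ₀(b−1) ∈ {0,1}) or (2m+b−1 ≢ 0 (mod p) and ℓ₀(b−1) = 0), and σ(b) = 0 otherwise; and define n(a,b) = σ(b) + ψ(a,b−1) − ψ(a,b). Then for 0 ≤ a ≤ p−2 and 1 ≤ b ≤ p−1, n(a,b) = 1 if and only if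 either (1 ≤ b ≤ m and a = m−b), or (m+1 ≤ b ≤ p−2m+1 and a = p−1+m−b), or (p−2m+1 ≤ b ≤ p−1 and a = p−2+m−b); and n(a,b) = 0 otherwise. -/
/-- Two congruent integers in `[0, n)` are equal. -/
theorem eq_of_modEq_of_mem_Ico {x y n : ℤ} (hx0 : 0 ≤ x) (hxn : x < n) (hy0 : 0 ≤ y)
    (hyn : y < n) (h : x ≡ y [ZMOD n]) : x = y := by
  rwa [Int.ModEq, Int.emod_eq_of_lt hx0 hxn, Int.emod_eq_of_lt hy0 hyn] at h

theorem ceil_div_eq_of_mul_lt_of_le_mul {n d k : ℤ} (hd : 0 < d) (hlt : (k - 1) * d < n)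
    (hle : n ≤ k * d) : ⌈(n : ℚ) / d⌉ = k := by
  have hd' : (0 : ℚ) < d := by exact_mod_cast hd
  rw [Int.ceil_eq_iff, lt_div_iff₀ hd', div_le_iff₀ hd']
  exact_mod_cast And.intro hlt hle

/-- When `p > 3m`, the multiplicities `n(a,b)` are `1` exactly
for the listed pairs `(a,b)` and `0` otherwise. -/
theorem nab_values_p_gt_three_m (p m : ℕ) (hp : p.Prime) (hodd : Odd p)
    (hm : 2 ≤ m) (hpm : 3 * m < p)
    (ℓ₁ : ℤ) (hℓ₁0 : 0 ≤ ℓ₁) (hℓ₁2 : ℓ₁ ≤ (p : ℤ) - 2)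
    (hℓ₁ : ℓ₁ ≡ (m : ℤ) * ((p : ℤ) - 2) [ZMOD (p : ℤ) - 1])
    (ℓ₀ : ℤ → ℤ) (hℓ₀0 : ∀ j, 0 ≤ ℓ₀ j) (hℓ₀2 : ∀ j, ℓ₀ j ≤ (p : ℤ) - 2)
    (hℓ₀ : ∀ j : ℤ,
      ℓ₀ j ≡ (m : ℤ) - j - ⌈(2 * (m : ℚ) + (j : ℚ)) / (p : ℚ)⌉ [ZMOD (p : ℤ) - 1])
    :
    ∀ a b : ℤ, 0 ≤ a → a ≤ (p : ℤ) - 2 → 1 ≤ b → b ≤ (p : ℤ) - 1 →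
      (nab p m ℓ₁ ℓ₀ a b = 1 ↔
        ((1 ≤ b ∧ b ≤ (m : ℤ) ∧ a = (m : ℤ) - b) ∨
         ((m : ℤ) + 1 ≤ b ∧ b ≤ (p : ℤ) - 2 * m + 1 ∧ a = (p : ℤ) - 1 + m - b) ∨
         ((p : ℤ) - 2 * m + 1 ≤ b ∧ b ≤ (p : ℤ) - 1 ∧ a = (p : ℤ) - 2 + m - b))) ∧
      (¬ ((1 ≤ b ∧ b ≤ (m : ℤ) ∧ a = (m : ℤ) - b) ∨
         ((m : ℤ) + 1 ≤ b ∧ b ≤ (p : ℤ) - 2 * m + 1 ∧ a = (p : ℤ) - 1 + m - b) ∨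
         ((p : ℤ) - 2 * m + 1 ≤ b ∧ b ≤ (p : ℤ) - 1 ∧ a = (p : ℤ) - 2 + m - b)) →
        nab p m ℓ₁ ℓ₀ a b = 0) := by
  intro a b ha0 ha1 hb0 hb1
  have hm' : (2 : ℤ) ≤ m := by exact_mod_cast hm
  have hpm' : 3 * (m : ℤ) < p := by exact_mod_cast hpm
  have hℓ₁_eq : ℓ₁ = (p : ℤ) - 1 - m := by
    refine eq_of_modEq_of_mem_Ico hℓ₁0 (by omega) (by omega) (by omega) (hℓ₁.trans ?_)
    exact (Int.modEq_iff_dvd.2 ⟨1 - (m : ℤ), by ring⟩)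
  have ceil_one : ∀ j : ℤ, 0 ≤ j → j ≤ p - 2 * m →
      ⌈(2 * (m : ℚ) + (j : ℚ)) / (p : ℚ)⌉ = 1 := by
    intro j h0 h1
    have := ceil_div_eq_of_mul_lt_of_le_mul (n := 2 * m + j) (d := p) (k := 1)
      (by omega) (by omega) (by omega)
    exact_mod_cast this
  have ceil_two : ∀ j : ℤ, (p : ℤ) - 2 * m < j → j < p →
      ⌈(2 * (m : ℚ) + (j : ℚ)) / (p : ℚ)⌉ = 2 := by
    intro j h0 h1
    have := ceil_div_eq_of_mul_lt_of_le_mul (n := 2 * m + j) (d := p) (k := 2)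
      (by omega) (by omega) (by omega)
    exact_mod_cast this
  have low : ∀ j : ℤ, 0 ≤ j → j < m → ℓ₀ j = m - j - 1 := by
    intro j h0 h1
    have h := hℓ₀ j
    rw [ceil_one j h0 (by omega)] at h
    have := hℓ₀2 j
    exact eq_of_modEq_of_mem_Ico (hℓ₀0 j) (by omega) (by omega) (by omega) h
  have mid : ∀ j : ℤ, (m : ℤ) ≤ j → j ≤ p - 2 * m → ℓ₀ j = p - 2 + m - j := by
    intro j h0 h1
    have h := hℓ₀ j
    rw [ceil_one j (by omega) h1] at h
    have := hℓ₀2 j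
    exact eq_of_modEq_of_mem_Ico (hℓ₀0 j) (by omega) (by omega) (by omega)
      (h.trans (Int.modEq_iff_dvd.2 ⟨1, by ring⟩))
  have high : ∀ j : ℤ, (p : ℤ) - 2 * m < j → j < p → ℓ₀ j = p - 3 + m - j := by
    intro j h0 h1
    have h := hℓ₀ j
    rw [ceil_two j h0 h1] at h
    have := hℓ₀2 j
    exact eq_of_modEq_of_mem_Ico (hℓ₀0 j) (by omega) (by omega) (by omega)
      (h.trans (Int.modEq_iff_dvd.2 ⟨1, by ring⟩))
  have dvd_imp : (p : ℤ) ∣ 2 * m + b - 1 → b = p - 2 * m + 1 := by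
    rintro ⟨k, hk⟩
    have hk0 : 0 < k := by by_contra! h; nlinarith
    have hk2 : k < 2 := by by_contra! h; nlinarith
    obtain rfl : k = 1 := by omega
    omega
  have sigma_eq : sigmaB p m ℓ₀ b = if b = m then 1 else 0 := by
    unfold sigmaB
    refine if_congr ?_ rfl rfl
    have hl := low (b - 1) (by omega)
    have hmi := mid (b - 1)
    have hh := high (b - 1)
    by_cases hd : (p : ℤ) ∣ 2 * m + b - 1
    · have := dvd_imp hd
      simp only [hd, not_true, true_and, false_and, or_false]
      omega
    · simp only [hd, not_false_eq_true, true_and, false_and, false_or]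
      omega
  have hl := low (b - 1) (by omega)
  have hmi := mid (b - 1)
  have hh := high (b - 1)
  have hl' := low b (by omega)
  have hmi' := mid b
  have hh' := high b
  unfold nab psi
  rw [sigma_eq, hℓ₁_eq]
  constructor
  · split_ifs <;> omega
  · intro h
    split_ifs <;> omega
end

section
/- Let p be an odd prime and m ≥ 2 an integer with p > 3m. For an integer j, let ℓ₁ denote the unique integer in [0, p−2] with ℓ₁ ≡ m(p−2) (mod p−1), and let ℓ₀(j) denote the unique integer in [0, p−2] with ℓ₀(j) ≡ m − j − ⌈(2m+j)/p⌉ (mod p−1). Define, for 0 ≤ a ≤ p−2, ψ(a,j) = 1 if a < ℓ₀(j)+1 and p−1−ℓ₁ ≤ a ≤ p−2; ψ(a,j) = −1 if a < p−1−ℓ₁ and ℓ₀(j)+1 ≤ a ≤ p−2; and ψ(a,j) = 0 otherwise. Define N(a) = m − ⌈m/(p−1)⌉ + ⌊(m−1−⌈(2m−1)/p⌉)/(p−1)⌋ + ψ(a, p−1). Then for every a with 0 ≤ a ≤ p−2: N(a) = m−2 if a = m−1, and N(a) = m−1 if a ≠ m−1. -/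
/-- Two congruent integers that both lie in `[0, n)` are equal. -/
theorem Int.ModEq.eq_of_mem_Ico {n x y : ℤ} (h : x ≡ y [ZMOD n])
    (hx : 0 ≤ x) (hxn : x < n) (hy : 0 ≤ y) (hyn : y < n) : x = y := by
  rwa [Int.ModEq, Int.emod_eq_of_lt hx hxn, Int.emod_eq_of_lt hy hyn] at h

/-- When `p > 3m`, the multiplicity
`N(a) = m − ⌈m/(p−1)⌉ + ⌊(m−1−⌈(2m−1)/p⌉)/(p−1)⌋ + ψ(a, p−1)` of the projective
indecomposable `U_{a,p}` equals `m−2` when `a = m−1` and `m−1` otherwise. -/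
theorem projective_multiplicity_p_gt_three_m (p m : ℕ) (hp : p.Prime)
    (hodd : Odd p) (hm : 2 ≤ m) (hpm : 3 * m < p)
    (ℓ₁ : ℤ) (hℓ₁0 : 0 ≤ ℓ₁) (hℓ₁2 : ℓ₁ ≤ (p : ℤ) - 2)
    (hℓ₁ : ℓ₁ ≡ (m : ℤ) * ((p : ℤ) - 2) [ZMOD (p : ℤ) - 1])
    (ℓ₀ : ℤ → ℤ) (hℓ₀0 : ∀ j, 0 ≤ ℓ₀ j) (hℓ₀2 : ∀ j, ℓ₀ j ≤ (p : ℤ) - 2)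
    (hℓ₀ : ∀ j : ℤ,
      ℓ₀ j ≡ (m : ℤ) - j - ⌈(2 * (m : ℚ) + (j : ℚ)) / (p : ℚ)⌉ [ZMOD (p : ℤ) - 1])
    :
    ∀ a : ℤ, 0 ≤ a → a ≤ (p : ℤ) - 2 →
      (m : ℤ) - ⌈(m : ℚ) / ((p : ℚ) - 1)⌉
        + ⌊((m : ℚ) - 1 - (⌈(2 * (m : ℚ) - 1) / (p : ℚ)⌉ : ℤ)) / ((p : ℚ) - 1)⌋
        + psi p ℓ₁ ℓ₀ a ((p : ℤ) - 1)
      = if a = (m : ℤ) - 1 then (m : ℤ) - 2 else (m : ℤ) - 1 := by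
  intro a ha0 ha
  have hmZ : (2 : ℤ) ≤ m := by exact_mod_cast hm
  have hpZ : 3 * (m : ℤ) < p := by exact_mod_cast hpm
  have hmQ : (2 : ℚ) ≤ m := by exact_mod_cast hm
  have hpQ : 3 * (m : ℚ) < p := by exact_mod_cast hpm
  have hp0 : (0 : ℚ) < p := by linarith
  have hp1 : (0 : ℚ) < (p : ℚ) - 1 := by linarith
  have ceil_m : ⌈(m : ℚ) / ((p : ℚ) - 1)⌉ = 1 := by
    rw [Int.ceil_eq_iff, lt_div_iff₀ hp1, div_le_iff₀ hp1]
    push_cast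
    constructor <;> linarith
  have ceil_two_m : ⌈(2 * (m : ℚ) - 1) / (p : ℚ)⌉ = 1 := by
    rw [Int.ceil_eq_iff, lt_div_iff₀ hp0, div_le_iff₀ hp0]
    push_cast
    constructor <;> linarith
  have floor_zero : ⌊((m : ℚ) - 1 - ((1 : ℤ) : ℚ)) / ((p : ℚ) - 1)⌋ = 0 := by
    rw [Int.floor_eq_iff, le_div_iff₀ hp1, div_lt_iff₀ hp1]
    push_cast
    constructor <;> linarith
  have ceil_j : ⌈(2 * (m : ℚ) + (((p : ℤ) - 1 : ℤ) : ℚ)) / (p : ℚ)⌉ = 2 := by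
    rw [Int.ceil_eq_iff, lt_div_iff₀ hp0, div_le_iff₀ hp0]
    push_cast
    constructor <;> linarith
  have hℓ₁_eq : ℓ₁ = (p : ℤ) - 1 - m := by
    refine (hℓ₁.trans ?_).eq_of_mem_Ico hℓ₁0 (by linarith) (by linarith) (by linarith)
    exact Int.modEq_iff_dvd.mpr ⟨1 - m, by ring⟩
  have hℓ₀_eq : ℓ₀ ((p : ℤ) - 1) = m - 2 := by
    have h := hℓ₀ ((p : ℤ) - 1)
    rw [ceil_j] at h
    refine (h.trans ?_).eq_of_mem_Ico (hℓ₀0 _) (by linarith [hℓ₀2 ((p : ℤ) - 1)])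
      (by linarith) (by linarith)
    exact Int.modEq_iff_dvd.mpr ⟨1, by ring⟩
  rw [ceil_m, ceil_two_m, floor_zero, psi, hℓ₀_eq, hℓ₁_eq]
  split_ifs <;> omega
end
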